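/- (Tight Typing and Termination) Let M be a closed term of Λ⊕^cbv. Then (1) ProbTerm(M) = sup { ‖𝔞‖ : there exists a tight derivation Π ⊳ ⊢ M : 𝔞 }, and (2) ETime(M) = sup { w : there exist 𝔞 and a tight derivation Π ⊳ ⊢_w M : 𝔞 } (as an equality in [0,∞]). -/

import Mathlib

open scoped ENNReal

namespace CbV

/-! ### Terms of the probabilistic call-by-value λ-calculus `Λ⊕^cbv` -/

mutual
inductive Val : Type
  | var : ℕ → Val
  | lam : ℕ → Tm → Val
inductive Tm : Type
  | val : Val → Tm
  | app : Val → Val → Tm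
  | choice : Tm → Tm → Tm
  | letin : ℕ → Tm → Tm → Tm
end

-- Substitution of a value for a variable.
mutual
def substV : Val → ℕ → Val → Val
  | .var y, x, V => if y = x then V else .var y
  | .lam y M, x, V => if y = x then .lam y M else .lam y (substT M x V)
def substT : Tm → ℕ → Val → Tm
  | .val W, x, V => .val (substV W x V)
  | .app W U, x, V => .app (substV W x V) (substV U x V)
  | .choice M N, x, V => .choice (substT M x V) (substT N x V)
  | .letin y N M, x, V => .letin y (substT N x V) (if y = x then M else substT M x V)
end

mutual
def fvV : Val → Finset ℕ
  | .var x => {x}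
  | .lam x M => fvT M \ {x}
def fvT : Tm → Finset ℕ
  | .val V => fvV V
  | .app V W => fvV V ∪ fvV W
  | .choice M N => fvT M ∪ fvT N
  | .letin x N M => fvT N ∪ (fvT M \ {x})
end

def Tm.Closed (M : Tm) : Prop := fvT M = ∅
def Val.Closed (V : Val) : Prop := fvV V = ∅

def Tm.isVal : Tm → Bool
  | .val _ => true
  | _ => false

/-! ### Multidistributions and the operational semantics -/

/-- Multidistributions over terms, represented as finite multisets of scaled terms. -/
abbrev MDist := Multiset (ℚ × Tm)

def scaleM (q : ℚ) (m : MDist) : MDist := m.map fun p => (q * p.1, p.2)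

/-- One-step reduction from terms to multidistributions. -/
inductive Step : Tm → MDist → Prop
  | beta (x : ℕ) (M : Tm) (V : Val) :
      Step (.app (.lam x M) V) {(1, substT M x V)}
  | letval (x : ℕ) (V : Val) (M : Tm) :
      Step (.letin x (.val V) M) {(1, substT M x V)}
  | choice (M N : Tm) : Step (.choice M N) {(1/2, M), (1/2, N)}
  | letstep {N : Tm} {m : MDist} (x : ℕ) (M : Tm) :
      Step N m → Step (.letin x N M) (m.map fun p => (p.1, Tm.letin x p.2 M))

/-- Lifting of one-step reduction to multidistributions. -/
inductive Lift : MDist → MDist → Prop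
  | value (V : Val) : Lift {(1, Tm.val V)} {(1, Tm.val V)}
  | single {M : Tm} {m : MDist} : Step M m → Lift {(1, M)} m
  | multi (s : Multiset (ℚ × Tm × MDist)) :
      (∀ x ∈ s, Lift {(1, x.2.1)} x.2.2) →
      Lift (s.map fun x => (x.1, x.2.1)) ((s.map fun x => scaleM x.1 x.2.2).sum)

/-- Functional presentation of one-step reduction (values, and stuck open
terms, are kept unchanged); it agrees with `Step` on closed non-value terms. -/
def stepF : Tm → MDist
  | .val V => {(1, .val V)}
  | .app (.lam x M) W => {(1, substT M x W)}
  | .app (.var y) W => {(1, .app (.var y) W)}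
  | .choice M N => {(1/2, M), (1/2, N)}
  | .letin x (.val V) M => {(1, substT M x V)}
  | .letin x N M => (stepF N).map fun p => (p.1, Tm.letin x p.2 M)

def mstepF (m : MDist) : MDist := (m.map fun p => scaleM p.1 (stepF p.2)).sum

/-- The unique reduction sequence `[M] = 𝔪₀ ⇛ 𝔪₁ ⇛ …` of a closed term. -/
def traj (M : Tm) (k : ℕ) : MDist := mstepF^[k] {(1, M)}

/-- `‖𝔪‖𝒱`: the probability that `𝔪` is a value. -/
def normV (m : MDist) : ℚ := ((m.filter fun p => p.2.isVal = true).map Prod.fst).sum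

/-- `eval_k(M)`: the probability that `M` terminates within `k` steps. -/
def evalP (k : ℕ) (M : Tm) : ℚ := normV (traj M k)

/-- `ProbTerm(M) = sup_k eval_k(M)`. -/
noncomputable def ProbTerm (M : Tm) : ℝ := ⨆ k : ℕ, ((evalP k M : ℚ) : ℝ)

/-- `etime_n(M) = Σ_{k<n} (1 - eval_k(M))`. -/
def etime (n : ℕ) (M : Tm) : ℚ := ∑ k ∈ Finset.range n, (1 - evalP k M)

/-- `ETime(M) = Σ_{k≥0} (1 - eval_k(M)) ∈ [0,∞]`, the expected runtime. -/
noncomputable def ETime (M : Tm) : ℝ≥0∞ :=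
  ∑' k : ℕ, ENNReal.ofReal ((1 : ℝ) - ((evalP k M : ℚ) : ℝ))

/-! ### Non-idempotent monadic intersection types -/

/-- Arrow types `𝖠 ::= 𝒜 → 𝔞`, where `𝒜` is an intersection type
(a finite multiset of scaled arrow types, represented as a list) and `𝔞`
is a type distribution (a multidistribution of intersection types,
represented as a list). -/
inductive ATy : Type
  | arr : List (ℚ × ATy) → List (ℚ × List (ℚ × ATy)) → ATy

/-- Intersection types. -/
abbrev ITy := List (ℚ × ATy)
/-- Type distributions. -/
abbrev DTy := List (ℚ × ITy)

/-- A type of any of the three kinds. -/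
inductive Ty : Type
  | arrow : ATy → Ty
  | inter : ITy → Ty
  | dist : DTy → Ty

/-- Typing contexts. -/
abbrev Ctx := ℕ → ITy

def emptyCtx : Ctx := fun _ => []

def scaleL {α : Type} (q : ℚ) (l : List (ℚ × α)) : List (ℚ × α) :=
  l.map fun p => (q * p.1, p.2)

def ctxUnion (Γ Δ : Ctx) : Ctx := fun x => Γ x ++ Δ x

/-- A type distribution is tight if every intersection type in it is empty. -/
def Tight (a : DTy) : Prop := ∀ p ∈ a, p.2 = ([] : ITy)

/-- `‖𝔞‖`: the sum of the probabilities occurring in a type distribution. -/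
def normD (a : DTy) : ℚ := (a.map Prod.fst).sum

/-- Typing derivations `Π ⊳ Γ ⊢_w M : σ`. -/
inductive Deriv : Ctx → ℚ → Tm → Ty → Type
  | var (x : ℕ) (A : ITy) :
      Deriv (Function.update emptyCtx x A) 0 (.val (.var x)) (.inter A)
  | zero (M : Tm) : Deriv emptyCtx 0 M (.dist [])
  | lam {Γ : Ctx} {w : ℚ} {M : Tm} (x : ℕ) (b : DTy) :
      Deriv Γ w M (.dist b) →
      Deriv (Function.update Γ x []) (w + 1) (.val (.lam x M)) (.arrow (.arr (Γ x) b))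
  | app {Γ Δ : Ctx} {w v : ℚ} {V W : Val} {A : ITy} {b : DTy} :
      Deriv Γ w (.val V) (.inter [(1, .arr A b)]) →
      Deriv Δ v (.val W) (.inter A) →
      Deriv (ctxUnion Γ Δ) (w + v) (.app V W) (.dist b)
  | choice {Γ Δ : Ctx} {w v : ℚ} {M N : Tm} {a b : DTy} :
      Deriv Γ w M (.dist a) → Deriv Δ v N (.dist b) →
      Deriv (ctxUnion (fun y => scaleL (1/2) (Γ y)) (fun y => scaleL (1/2) (Δ y)))
        (w / 2 + v / 2 + 1) (.choice M N)
        (.dist (scaleL (1/2) a ++ scaleL (1/2) b))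
  | letin {Γ : Ctx} {v : ℚ} (x : ℕ) {N M : Tm}
      (K : List (ℚ × ITy × Ctx × ℚ × DTy)) :
      (∀ k ∈ K, k.2.2.1 x = []) →
      ((i : Fin K.length) →
        Deriv (Function.update (K.get i).2.2.1 x (K.get i).2.1)
          (K.get i).2.2.2.1 M (.dist (K.get i).2.2.2.2)) →
      Deriv Γ v N (.dist (K.map fun k => (k.1, k.2.1))) →
      Deriv (ctxUnion Γ (fun y => (K.map fun k => scaleL k.1 (k.2.2.1 y)).flatten))
        ((K.map fun k => k.1 * k.2.2.2.1).sum + v + 1)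
        (.letin x N M)
        (.dist (K.map fun k => scaleL k.1 k.2.2.2.2).flatten)
  | tval {Γ : Ctx} {w : ℚ} {V : Val} {A : ITy} :
      Deriv Γ w (.val V) (.inter A) → Deriv Γ w (.val V) (.dist [(1, A)])
  | bang {V : Val} (I : List (ℚ × Ctx × ℚ × ATy)) :
      (∀ k ∈ I, 0 < k.1 ∧ k.1 ≤ 1) →
      ((i : Fin I.length) →
        Deriv (I.get i).2.1 (I.get i).2.2.1 (.val V) (.arrow (I.get i).2.2.2)) →
      Deriv (fun y => (I.map fun k => scaleL k.1 (k.2.1 y)).flatten)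
        ((I.map fun k => k.1 * k.2.2.1).sum) (.val V)
        (.inter (I.map fun k => (k.1, k.2.2.2)))

/-- Size of a derivation: the number of rules, excluding `!` and `Val`. -/
def Deriv.size : ∀ {Γ : Ctx} {w : ℚ} {M : Tm} {τ : Ty}, Deriv Γ w M τ → ℕ
  | _, _, _, _, .var _ _ => 1
  | _, _, _, _, .zero _ => 1
  | _, _, _, _, .lam _ _ d => d.size + 1
  | _, _, _, _, .app d e => d.size + e.size + 1
  | _, _, _, _, .choice d e => d.size + e.size + 1
  | _, _, _, _, .letin _ _ _ f d => d.size + (List.ofFn fun i => (f i).size).sum + 1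
  | _, _, _, _, .tval d => d.size
  | _, _, _, _, .bang _ _ f => (List.ofFn fun i => (f i).size).sum


/-! ### A presentation of typing by recursion on terms -/

def scaleC (p : ℚ) (Γ : Ctx) : Ctx := fun y => scaleL p (Γ y)

abbrev TPred := ℕ → Ctx → ℚ → DTy → Prop

def LamD (Q : ℚ → Prop) (P : TPred) (x : ℕ) : ITy → ℕ → Ctx → ℚ → Prop
  | [], n, Γ, w => n = 0 ∧ Γ = emptyCtx ∧ w = 0
  | (q, T) :: A, n, Γ, w => ∃ n1 Γ1 w1 b n2 Γ2 w2, Q q ∧ P n1 Γ1 w1 b ∧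
      T = .arr (Γ1 x) b ∧ LamD Q P x A n2 Γ2 w2 ∧ n = n1 + 1 + n2 ∧
      Γ = ctxUnion (scaleC q (Function.update Γ1 x [])) Γ2 ∧ w = q * (w1 + 1) + w2

def LetD (Q : ℚ → Prop) (P : TPred) (x : ℕ) : DTy → TPred
  | [], n, Γ, w, b => n = 0 ∧ Γ = emptyCtx ∧ w = 0 ∧ b = []
  | (p, A) :: a, n, Γ, w, b => ∃ n1 Γ1 w1 b1 n2 Γ2 w2 b2, Q p ∧ P n1 Γ1 w1 b1 ∧
      A = Γ1 x ∧ LetD Q P x a n2 Γ2 w2 b2 ∧ n = n1 + n2 ∧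
      Γ = ctxUnion (scaleC p (Function.update Γ1 x [])) Γ2 ∧ w = p * w1 + w2 ∧
      b = scaleL p b1 ++ b2

def Zr (n : ℕ) (Γ : Ctx) (w : ℚ) (b : DTy) : Prop := n = 0 ∧ Γ = emptyCtx ∧ w = 0 ∧ b = []

mutual
def DV (Q : ℚ → Prop) : Val → ITy → ℕ → Ctx → ℚ → Prop
  | .var y => fun A n Γ w => Γ = Function.update emptyCtx y A ∧ n = 0 ∧ w = 0
  | .lam x M => LamD Q (DT Q M) x
def DT (Q : ℚ → Prop) : Tm → TPred
  | .val V => fun n Γ w b => Zr n Γ w b ∨ ∃ A, b = [(1, A)] ∧ DV Q V A n Γ w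
  | .app V W => fun n Γ w b => Zr n Γ w b ∨ ∃ A n1 Γ1 w1 n2 Γ2 w2,
      DV Q V [(1, .arr A b)] n1 Γ1 w1 ∧ DV Q W A n2 Γ2 w2 ∧ n = n1 + n2 ∧
      Γ = ctxUnion Γ1 Γ2 ∧ w = w1 + w2
  | .choice M N => fun n Γ w b => Zr n Γ w b ∨ ∃ n1 Γ1 w1 b1 n2 Γ2 w2 b2,
      DT Q M n1 Γ1 w1 b1 ∧ DT Q N n2 Γ2 w2 b2 ∧ n = n1 + n2 + 1 ∧
      Γ = ctxUnion (scaleC (1/2) Γ1) (scaleC (1/2) Γ2) ∧ w = w1 / 2 + w2 / 2 + 1 ∧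
      b = scaleL (1/2) b1 ++ scaleL (1/2) b2
  | .letin x N M => fun n Γ w b => Zr n Γ w b ∨ ∃ a n1 Γ1 w1 n2 Γ2 w2,
      DT Q N n1 Γ1 w1 a ∧ LetD Q (DT Q M) x a n2 Γ2 w2 b ∧ n = n1 + n2 + 1 ∧
      Γ = ctxUnion Γ1 Γ2 ∧ w = w2 + w1 + 1
end

theorem DT_zero (Q : ℚ → Prop) (M : Tm) : DT Q M 0 emptyCtx 0 [] := by
  cases M <;> exact Or.inl ⟨rfl, rfl, rfl, rfl⟩

/-! ### Lists and contexts -/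

@[simp] theorem scaleL_nil {α : Type} (q : ℚ) : scaleL q ([] : List (ℚ × α)) = [] := rfl
@[simp] theorem scaleL_cons {α : Type} (q : ℚ) (p : ℚ × α) (l : List (ℚ × α)) :
    scaleL q (p :: l) = (q * p.1, p.2) :: scaleL q l := rfl
@[simp] theorem scaleL_append {α : Type} (q : ℚ) (l l' : List (ℚ × α)) :
    scaleL q (l ++ l') = scaleL q l ++ scaleL q l' := by simp [scaleL]
@[simp] theorem scaleL_eq_nil {α : Type} (q : ℚ) (l : List (ℚ × α)) :
    scaleL q l = [] ↔ l = [] := by simp [scaleL]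
@[simp] theorem scaleL_one {α : Type} (l : List (ℚ × α)) : scaleL 1 l = l := by simp [scaleL]
theorem scaleL_mul {α : Type} (p q : ℚ) (l : List (ℚ × α)) :
    scaleL (p * q) l = scaleL p (scaleL q l) := by simp [scaleL, mul_assoc]
@[simp] theorem scaleC_one (Γ : Ctx) : scaleC 1 Γ = Γ := by funext y; simp [scaleC]
theorem scaleC_mul (p q : ℚ) (Γ : Ctx) : scaleC (p * q) Γ = scaleC p (scaleC q Γ) := by
  funext y; simp [scaleC, scaleL_mul]
@[simp] theorem scaleC_empty (q : ℚ) : scaleC q emptyCtx = emptyCtx := rfl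
@[simp] theorem scaleC_eq_empty (q : ℚ) (Γ : Ctx) : scaleC q Γ = emptyCtx ↔ Γ = emptyCtx := by
  simp [funext_iff, scaleC, emptyCtx]
theorem scaleC_union (p : ℚ) (Γ Δ : Ctx) :
    scaleC p (ctxUnion Γ Δ) = ctxUnion (scaleC p Γ) (scaleC p Δ) := by
  funext y; simp [scaleC, ctxUnion]
@[simp] theorem union_empty (Γ : Ctx) : ctxUnion Γ emptyCtx = Γ := by
  funext y; simp [ctxUnion, emptyCtx]
@[simp] theorem empty_union (Γ : Ctx) : ctxUnion emptyCtx Γ = Γ := by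
  funext y; simp [ctxUnion, emptyCtx]
@[simp] theorem union_eq_empty (Γ Δ : Ctx) :
    ctxUnion Γ Δ = emptyCtx ↔ Γ = emptyCtx ∧ Δ = emptyCtx := by
  simp [funext_iff, ctxUnion, emptyCtx, forall_and]
theorem union_assoc (Γ Δ Θ : Ctx) :
    ctxUnion (ctxUnion Γ Δ) Θ = ctxUnion Γ (ctxUnion Δ Θ) := by
  funext y; simp [ctxUnion]
theorem update_union (Γ Δ : Ctx) (x : ℕ) : Function.update (ctxUnion Γ Δ) x [] =
    ctxUnion (Function.update Γ x []) (Function.update Δ x []) := by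
  funext y; by_cases h : y = x
  · subst h; simp [ctxUnion]
  · simp [ctxUnion, h]
theorem update_scale (p : ℚ) (Γ : Ctx) (x : ℕ) : Function.update (scaleC p Γ) x [] =
    scaleC p (Function.update Γ x []) := by
  funext y; by_cases h : y = x
  · subst h; simp [scaleC]
  · simp [scaleC, h]
@[simp] theorem update_empty (x : ℕ) : Function.update emptyCtx x [] = emptyCtx := by
  funext y; by_cases h : y = x
  · subst h; simp [emptyCtx]
  · simp [emptyCtx, h]
theorem update_self {Γ : Ctx} {x : ℕ} (h : Γ x = []) : Function.update Γ x [] = Γ := by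
  rw [← h]; simp

/-! ### Relevance -/

theorem LamD_rel {Q P x} {y : ℕ} (h : y ≠ x → ∀ n Γ w b, P n Γ w b → Γ y = []) :
    ∀ A n Γ w, LamD Q P x A n Γ w → Γ y = []
  | [], n, Γ, w, ⟨_, h1, _⟩ => by rw [h1]; rfl
  | (q, T) :: A, n, Γ, w, ⟨n1, Γ1, w1, b, n2, Γ2, w2, hQ, hP, hT, hL, hn, hΓ, hw⟩ => by
    have := LamD_rel h A _ _ _ hL
    rw [hΓ]
    by_cases e : y = x
    · subst e; simp [ctxUnion, scaleC, this]
    · simp [ctxUnion, scaleC, this, e, h e _ _ _ _ hP]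

theorem LetD_rel {Q P x} {y : ℕ} (h : y ≠ x → ∀ n Γ w b, P n Γ w b → Γ y = []) :
    ∀ a n Γ w b, LetD Q P x a n Γ w b → Γ y = []
  | [], n, Γ, w, _, ⟨_, h1, _⟩ => by rw [h1]; rfl
  | (q, T) :: A, n, Γ, w, b,
      ⟨n1, Γ1, w1, b1, n2, Γ2, w2, b2, hQ, hP, hT, hL, hn, hΓ, hw, hb⟩ => by
    have := LetD_rel h A _ _ _ _ hL
    rw [hΓ]
    by_cases e : y = x
    · subst e; simp [ctxUnion, scaleC, this]
    · simp [ctxUnion, scaleC, this, e, h e _ _ _ _ hP]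

mutual
theorem DV_rel {Q : ℚ → Prop} {y : ℕ} : ∀ (V : Val), y ∉ fvV V →
    ∀ A n Γ w, DV Q V A n Γ w → Γ y = []
  | .var x, hy, A, n, Γ, w, h => by
    simp only [DV] at h
    simp only [fvV, Finset.mem_singleton] at hy
    rw [h.1]; simp [hy, emptyCtx]
  | .lam x M, hy, A, n, Γ, w, h => by
    simp only [DV] at h
    simp only [fvV, Finset.mem_sdiff, Finset.mem_singleton, not_and, not_not] at hy
    exact LamD_rel (fun e n Γ w b hb => DT_rel M (fun h' => e (hy h')) n Γ w b hb) _ _ _ _ h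
theorem DT_rel {Q : ℚ → Prop} {y : ℕ} : ∀ (M : Tm), y ∉ fvT M →
    ∀ n Γ w b, DT Q M n Γ w b → Γ y = []
  | .val V, hy, n, Γ, w, b, h => by
    simp only [DT] at h
    simp only [fvT] at hy
    rcases h with h | ⟨A, _, h⟩
    · rw [h.2.1]; rfl
    · exact DV_rel V hy _ _ _ _ h
  | .app V W, hy, n, Γ, w, b, h => by
    simp only [DT] at h
    simp only [fvT, Finset.mem_union, not_or] at hy
    rcases h with h | ⟨A, n1, Γ1, w1, n2, Γ2, w2, h1, h2, _, rfl, _⟩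
    · rw [h.2.1]; rfl
    · simp [ctxUnion, DV_rel V hy.1 _ _ _ _ h1, DV_rel W hy.2 _ _ _ _ h2]
  | .choice M N, hy, n, Γ, w, b, h => by
    simp only [DT] at h
    simp only [fvT, Finset.mem_union, not_or] at hy
    rcases h with h | ⟨n1, Γ1, w1, b1, n2, Γ2, w2, b2, h1, h2, _, rfl, _⟩
    · rw [h.2.1]; rfl
    · simp [ctxUnion, scaleC, DT_rel M hy.1 _ _ _ _ h1, DT_rel N hy.2 _ _ _ _ h2]
  | .letin x N M, hy, n, Γ, w, b, h => by
    simp only [DT] at h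
    simp only [fvT, Finset.mem_union, not_or, Finset.mem_sdiff, Finset.mem_singleton,
      not_and, not_not] at hy
    rcases h with h | ⟨a, n1, Γ1, w1, n2, Γ2, w2, h1, h2, _, rfl, _⟩
    · rw [h.2.1]; rfl
    · simp [ctxUnion, DT_rel N hy.1 _ _ _ _ h1,
        LetD_rel (fun e n Γ w b hb => DT_rel M (fun h' => e (hy.2 h')) n Γ w b hb) _ _ _ _ _ h2]
end

theorem DV_closed {Q V A n Γ w} (hV : fvV V = ∅) (h : DV Q V A n Γ w) : Γ = emptyCtx := by
  funext y; exact DV_rel V (by simp [hV]) _ _ _ _ h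
theorem DT_closed {Q M n Γ w b} (hV : fvT M = ∅) (h : DT Q M n Γ w b) : Γ = emptyCtx := by
  funext y; exact DT_rel M (by simp [hV]) _ _ _ _ h

/-! ### Structural lemmas: splitting, joining, scaling -/

theorem LamD_append {Q P x} : ∀ {A B n m Γ Δ w v}, LamD Q P x A n Γ w → LamD Q P x B m Δ v →
    LamD Q P x (A ++ B) (n + m) (ctxUnion Γ Δ) (w + v)
  | [], B, n, m, Γ, Δ, w, v, ⟨h1, h2, h3⟩, h => by subst h1 h2 h3; simpa using h
  | (q, T) :: A, B, n, m, Γ, Δ, w, v,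
      ⟨n1, Γ1, w1, b, n2, Γ2, w2, hQ, hP, hT, hL, hn, hΓ, hw⟩, h =>
    ⟨n1, Γ1, w1, b, _, _, _, hQ, hP, hT, LamD_append hL h, by omega,
      by rw [hΓ, union_assoc], by rw [hw]; ring⟩

theorem LamD_scale {Q P x} {p : ℚ} (hp : ∀ q, Q q → Q (p * q)) :
    ∀ {A n Γ w}, LamD Q P x A n Γ w → LamD Q P x (scaleL p A) n (scaleC p Γ) (p * w)
  | [], n, Γ, w, ⟨h1, h2, h3⟩ => by subst h1 h2 h3; simp [LamD]
  | (q, T) :: A, n, Γ, w,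
      ⟨n1, Γ1, w1, b, n2, Γ2, w2, hQ, hP, hT, hL, hn, hΓ, hw⟩ =>
    ⟨n1, Γ1, w1, b, _, _, _, hp _ hQ, hP, hT, LamD_scale hp hL, hn,
      by rw [hΓ, scaleC_union, scaleC_mul], by rw [hw]; ring⟩

theorem LamD_split {Q P x} : ∀ {A B n w}, LamD Q P x (A ++ B) n emptyCtx w →
    ∃ n1 w1 n2 w2, LamD Q P x A n1 emptyCtx w1 ∧ LamD Q P x B n2 emptyCtx w2 ∧
      n = n1 + n2 ∧ w = w1 + w2
  | [], B, n, w, h => ⟨0, 0, n, w, ⟨rfl, rfl, rfl⟩, h, by simp, by simp⟩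
  | (q, T) :: A, B, n, w,
      ⟨n1, Γ1, w1, b, n2, Γ2, w2, hQ, hP, hT, hL, hn, hΓ, hw⟩ => by
    have hΓ' := (union_eq_empty _ _).1 hΓ.symm
    rw [hΓ'.2] at hL
    obtain ⟨m1, v1, m2, v2, h1, h2, h3, h4⟩ := LamD_split hL
    exact ⟨_, _, m2, v2, ⟨n1, Γ1, w1, b, m1, emptyCtx, v1, hQ, hP, hT, h1, rfl,
      by rw [hΓ'.1]; simp, rfl⟩, h2, by omega, by rw [hw, h4]; ring⟩

theorem LamD_unscale {P x} {p : ℚ} : ∀ {A n w},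
    LamD (fun _ => True) P x (scaleL p A) n emptyCtx w →
    ∃ w', LamD (fun _ => True) P x A n emptyCtx w' ∧ w = p * w'
  | [], n, w, ⟨h1, h2, h3⟩ => ⟨0, ⟨h1, rfl, rfl⟩, by simp [h3]⟩
  | (q, T) :: A, n, w,
      ⟨n1, Γ1, w1, b, n2, Γ2, w2, hQ, hP, hT, hL, hn, hΓ, hw⟩ => by
    have hΓ' := (union_eq_empty _ _).1 hΓ.symm
    rw [hΓ'.2] at hL
    obtain ⟨v1, h1, h2⟩ := LamD_unscale hL
    have h3 := (scaleC_eq_empty _ _).1 hΓ'.1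
    exact ⟨_, ⟨n1, Γ1, w1, b, n2, emptyCtx, v1, trivial, hP, hT, h1, hn,
      by rw [h3]; simp, rfl⟩, by rw [hw, h2]; ring⟩

theorem LetD_append {Q P x} : ∀ {A B n m w v b c}, LetD Q P x A n emptyCtx w b →
    LetD Q P x B m emptyCtx v c → LetD Q P x (A ++ B) (n + m) emptyCtx (w + v) (b ++ c)
  | [], B, n, m, w, v, b, c, ⟨h1, h2, h3, h4⟩, h => by subst h1 h3 h4; simpa using h
  | (q, T) :: A, B, n, m, w, v, b, c,
      ⟨n1, Γ1, w1, b1, n2, Γ2, w2, b2, hQ, hP, hT, hL, hn, hΓ, hw, hb⟩, h => by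
    have hΓ' := (union_eq_empty _ _).1 hΓ.symm
    rw [hΓ'.2] at hL
    exact ⟨n1, Γ1, w1, b1, _, _, _, _, hQ, hP, hT, LetD_append hL h, by omega,
      by rw [hΓ'.1]; simp, by rw [hw]; ring, by rw [hb, List.append_assoc]⟩

theorem LetD_scale {Q P x} {p : ℚ} (hp : ∀ q, Q q → Q (p * q)) :
    ∀ {A n Γ w b}, LetD Q P x A n Γ w b →
      LetD Q P x (scaleL p A) n (scaleC p Γ) (p * w) (scaleL p b)
  | [], n, Γ, w, b, ⟨h1, h2, h3, h4⟩ => by subst h1 h2 h3 h4; simp [LetD]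
  | (q, T) :: A, n, Γ, w, b,
      ⟨n1, Γ1, w1, b1, n2, Γ2, w2, b2, hQ, hP, hT, hL, hn, hΓ, hw, hb⟩ =>
    ⟨n1, Γ1, w1, b1, _, _, _, _, hp _ hQ, hP, hT, LetD_scale hp hL, hn,
      by rw [hΓ, scaleC_union, scaleC_mul], by rw [hw]; ring,
      by rw [hb, scaleL_append, scaleL_mul]⟩

theorem LetD_split {Q P x} : ∀ {A B n w b}, LetD Q P x (A ++ B) n emptyCtx w b →
    ∃ n1 w1 b1 n2 w2 b2, LetD Q P x A n1 emptyCtx w1 b1 ∧ LetD Q P x B n2 emptyCtx w2 b2 ∧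
      n = n1 + n2 ∧ w = w1 + w2 ∧ b = b1 ++ b2
  | [], B, n, w, b, h => ⟨0, 0, [], n, w, b, ⟨rfl, rfl, rfl, rfl⟩, h, by simp, by simp, by simp⟩
  | (q, T) :: A, B, n, w, b,
      ⟨n1, Γ1, w1, b1, n2, Γ2, w2, b2, hQ, hP, hT, hL, hn, hΓ, hw, hb⟩ => by
    have hΓ' := (union_eq_empty _ _).1 hΓ.symm
    rw [hΓ'.2] at hL
    obtain ⟨m1, v1, c1, m2, v2, c2, h1, h2, h3, h4, h5⟩ := LetD_split hL
    exact ⟨_, _, _, m2, v2, c2, ⟨n1, Γ1, w1, b1, m1, emptyCtx, v1, c1, hQ, hP, hT, h1, rfl,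
      by rw [hΓ'.1]; simp, rfl, rfl⟩, h2, by omega, by rw [hw, h4]; ring,
      by rw [hb, h5, List.append_assoc]⟩

theorem LetD_unscale {P x} {p : ℚ} : ∀ {A n w b},
    LetD (fun _ => True) P x (scaleL p A) n emptyCtx w b →
    ∃ w' b', LetD (fun _ => True) P x A n emptyCtx w' b' ∧ w = p * w' ∧ b = scaleL p b'
  | [], n, w, b, ⟨h1, h2, h3, h4⟩ => ⟨0, [], ⟨h1, rfl, rfl, rfl⟩, by simp [h3], by simp [h4]⟩
  | (q, T) :: A, n, w, b,
      ⟨n1, Γ1, w1, b1, n2, Γ2, w2, b2, hQ, hP, hT, hL, hn, hΓ, hw, hb⟩ => by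
    have hΓ' := (union_eq_empty _ _).1 hΓ.symm
    rw [hΓ'.2] at hL
    obtain ⟨v1, c1, h1, h2, h4⟩ := LetD_unscale hL
    have h3 := (scaleC_eq_empty _ _).1 hΓ'.1
    exact ⟨_, _, ⟨n1, Γ1, w1, b1, n2, emptyCtx, v1, c1, trivial, hP, hT, h1, hn,
      by rw [h3]; simp, rfl, rfl⟩, by rw [hw, h2]; ring,
      by rw [hb, h4, scaleL_append, scaleL_mul]⟩

/-! ### Substitution -/

abbrev Any : ℚ → Prop := fun _ => True
abbrev Unit01 : ℚ → Prop := fun q => 0 < q ∧ q ≤ 1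

theorem Unit01_mul {p : ℚ} (hp : Unit01 p) : ∀ q, Unit01 q → Unit01 (p * q) :=
  fun _ hq => ⟨mul_pos hp.1 hq.1, mul_le_one₀ hp.2 hq.1.le hq.2⟩

theorem LamD_sub {P P' R : TPred} {x y z : ℕ} (hxy : y ≠ x)
    (hP : ∀ n Γ w b m v, P n Γ w b → LamD Any R z (Γ x) m emptyCtx v →
      P' (n + m) (Function.update Γ x []) (w + v) b) :
    ∀ A n Γ w m v, LamD Any P y A n Γ w → LamD Any R z (Γ x) m emptyCtx v →
      LamD Any P' y A (n + m) (Function.update Γ x []) (w + v)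
  | [], n, Γ, w, m, v, ⟨h1, h2, h3⟩, h => by
    subst h1 h2 h3
    obtain ⟨rfl, -, rfl⟩ := h
    simp [LamD]
  | (q, T) :: A, n, Γ, w, m, v,
      ⟨n1, Γ1, w1, b, n2, Γ2, w2, hQ, h1, hT, hL, hn, hΓ, hw⟩, h => by
    subst hΓ
    have hx : ctxUnion (scaleC q (Function.update Γ1 y [])) Γ2 x = scaleL q (Γ1 x) ++ Γ2 x := by
      simp [ctxUnion, scaleC, hxy.symm]
    rw [hx] at h
    obtain ⟨m1, v1, m2, v2, ha, hb, rfl, rfl⟩ := LamD_split h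
    obtain ⟨v1', ha', rfl⟩ := LamD_unscale ha
    refine ⟨_, _, _, b, _, _, _, trivial, hP _ _ _ _ _ _ h1 ha', ?_,
      LamD_sub hxy hP A _ _ _ _ _ hL hb, by omega, ?_, by rw [hw]; ring⟩
    · rw [hT, Function.update_of_ne hxy]
    · rw [update_union, update_scale, Function.update_comm hxy]

theorem LetD_sub {P P' R : TPred} {x y z : ℕ} (hxy : y ≠ x)
    (hP : ∀ n Γ w b m v, P n Γ w b → LamD Any R z (Γ x) m emptyCtx v →
      P' (n + m) (Function.update Γ x []) (w + v) b) :
    ∀ a n Γ w b m v, LetD Any P y a n Γ w b → LamD Any R z (Γ x) m emptyCtx v →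
      LetD Any P' y a (n + m) (Function.update Γ x []) (w + v) b
  | [], n, Γ, w, b, m, v, ⟨h1, h2, h3, h4⟩, h => by
    subst h1 h2 h3 h4
    obtain ⟨rfl, -, rfl⟩ := h
    simp [LetD]
  | (q, T) :: A, n, Γ, w, b, m, v,
      ⟨n1, Γ1, w1, b1, n2, Γ2, w2, b2, hQ, h1, hT, hL, hn, hΓ, hw, hb'⟩, h => by
    subst hΓ
    have hx : ctxUnion (scaleC q (Function.update Γ1 y [])) Γ2 x = scaleL q (Γ1 x) ++ Γ2 x := by
      simp [ctxUnion, scaleC, hxy.symm]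
    rw [hx] at h
    obtain ⟨m1, v1, m2, v2, ha, hb, rfl, rfl⟩ := LamD_split h
    obtain ⟨v1', ha', rfl⟩ := LamD_unscale ha
    refine ⟨_, _, _, b1, _, _, _, b2, trivial, hP _ _ _ _ _ _ h1 ha', ?_,
      LetD_sub hxy hP A _ _ _ _ _ _ hL hb, by omega, ?_, by rw [hw]; ring, hb'⟩
    · rw [hT, Function.update_of_ne hxy]
    · rw [update_union, update_scale, Function.update_comm hxy]

mutual
theorem DV_sub {x z : ℕ} {L : Tm} : ∀ (W : Val) (A n Γ w m v), DV Any W A n Γ w →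
    LamD Any (DT Any L) z (Γ x) m emptyCtx v →
    DV Any (substV W x (.lam z L)) A (n + m) (Function.update Γ x []) (w + v)
  | .var y, A, n, Γ, w, m, v, h, h' => by
    simp only [DV] at h
    obtain ⟨rfl, rfl, rfl⟩ := h
    simp only [substV]
    split_ifs with e
    · subst e
      simpa [DV] using h'
    · have e' : x ≠ y := fun h => e h.symm
      rw [Function.update_of_ne e'] at h'
      obtain ⟨rfl, -, rfl⟩ := h'
      refine ⟨?_, rfl, by simp⟩
      rw [update_self]
      rw [Function.update_of_ne e']; rfl
  | .lam y M, A, n, Γ, w, m, v, h, h' => by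
    simp only [DV] at h
    simp only [substV]
    split_ifs with e
    · subst e
      have hy : Γ y = [] := LamD_rel (fun e => absurd rfl e) _ _ _ _ h
      rw [hy] at h'
      obtain ⟨rfl, -, rfl⟩ := h'
      rw [update_self hy]
      simpa [DV] using h
    · simp only [DV]
      exact LamD_sub e (fun n Γ w b m v => DT_sub M n Γ w b m v) _ _ _ _ _ _ h h'
theorem DT_sub {x z : ℕ} {L : Tm} : ∀ (M : Tm) (n Γ w b m v), DT Any M n Γ w b →
    LamD Any (DT Any L) z (Γ x) m emptyCtx v →
    DT Any (substT M x (.lam z L)) (n + m) (Function.update Γ x []) (w + v) b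
  | .val V, n, Γ, w, b, m, v, h, h' => by
    simp only [DT] at h
    simp only [substT, DT]
    rcases h with ⟨rfl, rfl, rfl, rfl⟩ | ⟨A, rfl, h⟩
    · obtain ⟨rfl, -, rfl⟩ := h'
      left; simp [Zr]
    · exact Or.inr ⟨A, rfl, DV_sub V _ _ _ _ _ _ h h'⟩
  | .app V W, n, Γ, w, b, m, v, h, h' => by
    simp only [DT] at h
    simp only [substT, DT]
    rcases h with ⟨rfl, rfl, rfl, rfl⟩ | ⟨A, n1, Γ1, w1, n2, Γ2, w2, h1, h2, rfl, rfl, rfl⟩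
    · obtain ⟨rfl, -, rfl⟩ := h'
      left; simp [Zr]
    · obtain ⟨m1, v1, m2, v2, ha, hb, rfl, rfl⟩ := LamD_split h'
      exact Or.inr ⟨A, _, _, _, _, _, _, DV_sub V _ _ _ _ _ _ h1 ha, DV_sub W _ _ _ _ _ _ h2 hb,
        by omega, update_union _ _ _, by ring⟩
  | .choice M N, n, Γ, w, b, m, v, h, h' => by
    simp only [DT] at h
    simp only [substT, DT]
    rcases h with ⟨rfl, rfl, rfl, rfl⟩ |
      ⟨n1, Γ1, w1, b1, n2, Γ2, w2, b2, h1, h2, rfl, rfl, rfl, rfl⟩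
    · obtain ⟨rfl, -, rfl⟩ := h'
      left; simp [Zr]
    · obtain ⟨m1, v1, m2, v2, ha, hb, rfl, rfl⟩ := LamD_split h'
      obtain ⟨v1, ha', rfl⟩ := LamD_unscale ha
      obtain ⟨v2, hb', rfl⟩ := LamD_unscale hb
      exact Or.inr ⟨_, _, _, b1, _, _, _, b2, DT_sub M _ _ _ _ _ _ h1 ha',
        DT_sub N _ _ _ _ _ _ h2 hb', by omega,
        by rw [update_union, update_scale, update_scale], by ring, rfl⟩
  | .letin y N M, n, Γ, w, b, m, v, h, h' => by
    simp only [DT] at h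
    simp only [substT, DT]
    rcases h with ⟨rfl, rfl, rfl, rfl⟩ | ⟨a, n1, Γ1, w1, n2, Γ2, w2, h1, h2, rfl, rfl, rfl⟩
    · obtain ⟨rfl, -, rfl⟩ := h'
      left; simp [Zr]
    · obtain ⟨m1, v1, m2, v2, ha, hb, rfl, rfl⟩ := LamD_split h'
      right
      split_ifs with e
      · subst e
        have hy : Γ2 y = [] := LetD_rel (fun e => absurd rfl e) _ _ _ _ _ h2
        rw [hy] at hb
        obtain ⟨rfl, -, rfl⟩ := hb
        exact ⟨a, _, _, _, _, _, _, DT_sub N _ _ _ _ _ _ h1 ha, h2, by omega,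
          by rw [update_union, update_self hy], by ring⟩
      · exact ⟨a, _, _, _, _, _, _, DT_sub N _ _ _ _ _ _ h1 ha,
          LetD_sub e (fun n Γ w b m v => DT_sub M n Γ w b m v) _ _ _ _ _ _ _ h2 hb, by omega,
          by rw [update_union], by ring⟩
end

/-! ### Anti-substitution -/

theorem LamD_anti {P P' R : TPred} {x y z : ℕ} (hxy : y ≠ x)
    (hP : ∀ n Γ w b, P' n Γ w b → ∃ n1 Γ1 w1 m v, P n1 Γ1 w1 b ∧
      LamD Unit01 R z (Γ1 x) m emptyCtx v ∧ Γ = Function.update Γ1 x [] ∧ w = w1 + v) :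
    ∀ A n Γ w, LamD Unit01 P' y A n Γ w → ∃ n1 Γ1 w1 m v, LamD Unit01 P y A n1 Γ1 w1 ∧
      LamD Unit01 R z (Γ1 x) m emptyCtx v ∧ Γ = Function.update Γ1 x [] ∧ w = w1 + v
  | [], n, Γ, w, ⟨h1, h2, h3⟩ => by
    subst h1 h2 h3
    exact ⟨0, emptyCtx, 0, 0, 0, ⟨rfl, rfl, rfl⟩, ⟨rfl, rfl, rfl⟩, by simp, by simp⟩
  | (q, T) :: A, n, Γ, w,
      ⟨n1, Γ1, w1, b, n2, Γ2, w2, hQ, h1, hT, hL, hn, hΓ, hw⟩ => by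
    obtain ⟨k1, Δ1, u1, m1, v1, ha, hb, rfl, rfl⟩ := hP _ _ _ _ h1
    obtain ⟨k2, Δ2, u2, m2, v2, hc, hd, rfl, rfl⟩ := LamD_anti hxy hP _ _ _ _ hL
    refine ⟨_, _, _, m1 + m2, q * v1 + v2, ⟨k1, Δ1, u1, b, k2, Δ2, u2, hQ, ha, ?_, hc, rfl, rfl, rfl⟩,
      ?_, ?_, by rw [hw]; ring⟩
    · rw [hT, Function.update_of_ne hxy]
    · have hx : ctxUnion (scaleC q (Function.update Δ1 y [])) Δ2 x = scaleL q (Δ1 x) ++ Δ2 x := by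
        simp [ctxUnion, scaleC, hxy.symm]
      rw [hx]
      simpa using LamD_append (LamD_scale (Unit01_mul hQ) hb) hd
    · rw [hΓ, update_union, update_scale, Function.update_comm hxy]

theorem LetD_anti {P P' R : TPred} {x y z : ℕ} (hxy : y ≠ x)
    (hP : ∀ n Γ w b, P' n Γ w b → ∃ n1 Γ1 w1 m v, P n1 Γ1 w1 b ∧
      LamD Unit01 R z (Γ1 x) m emptyCtx v ∧ Γ = Function.update Γ1 x [] ∧ w = w1 + v) :
    ∀ a n Γ w b, LetD Unit01 P' y a n Γ w b → ∃ n1 Γ1 w1 m v, LetD Unit01 P y a n1 Γ1 w1 b ∧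
      LamD Unit01 R z (Γ1 x) m emptyCtx v ∧ Γ = Function.update Γ1 x [] ∧ w = w1 + v
  | [], n, Γ, w, b, ⟨h1, h2, h3, h4⟩ => by
    subst h1 h2 h3 h4
    exact ⟨0, emptyCtx, 0, 0, 0, ⟨rfl, rfl, rfl, rfl⟩, ⟨rfl, rfl, rfl⟩, by simp, by simp⟩
  | (q, T) :: A, n, Γ, w, b,
      ⟨n1, Γ1, w1, b1, n2, Γ2, w2, b2, hQ, h1, hT, hL, hn, hΓ, hw, hb'⟩ => by
    obtain ⟨k1, Δ1, u1, m1, v1, ha, hb, rfl, rfl⟩ := hP _ _ _ _ h1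
    obtain ⟨k2, Δ2, u2, m2, v2, hc, hd, rfl, rfl⟩ := LetD_anti hxy hP _ _ _ _ _ hL
    refine ⟨_, _, _, m1 + m2, q * v1 + v2,
      ⟨k1, Δ1, u1, b1, k2, Δ2, u2, b2, hQ, ha, ?_, hc, rfl, rfl, rfl, hb'⟩,
      ?_, ?_, by rw [hw]; ring⟩
    · rw [hT, Function.update_of_ne hxy]
    · have hx : ctxUnion (scaleC q (Function.update Δ1 y [])) Δ2 x = scaleL q (Δ1 x) ++ Δ2 x := by
        simp [ctxUnion, scaleC, hxy.symm]
      rw [hx]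
      simpa using LamD_append (LamD_scale (Unit01_mul hQ) hb) hd
    · rw [hΓ, update_union, update_scale, Function.update_comm hxy]

theorem half01 : Unit01 (1/2) := by constructor <;> norm_num

mutual
theorem DV_anti {x z : ℕ} {L : Tm} (hL : fvV (.lam z L) = ∅) : ∀ (W : Val) (A n Γ w),
    DV Unit01 (substV W x (.lam z L)) A n Γ w → ∃ n1 Γ1 w1 m v, DV Unit01 W A n1 Γ1 w1 ∧
    LamD Unit01 (DT Unit01 L) z (Γ1 x) m emptyCtx v ∧ Γ = Function.update Γ1 x [] ∧ w = w1 + v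
  | .var y, A, n, Γ, w, h => by
    simp only [substV] at h
    split_ifs at h with e
    · subst e
      obtain rfl := DV_closed hL h
      refine ⟨0, Function.update emptyCtx y A, 0, n, w, ⟨rfl, rfl, rfl⟩, ?_, ?_, by simp⟩
      · simpa [DV] using h
      · simp
    · have e' : x ≠ y := fun h => e h.symm
      have hx : Γ x = [] := DV_rel (.var y) (by simpa [fvV] using e') _ _ _ _ h
      exact ⟨n, Γ, w, 0, 0, h, by rw [hx]; exact ⟨rfl, rfl, rfl⟩, (update_self hx).symm, by simp⟩
  | .lam y M, A, n, Γ, w, h => by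
    simp only [substV] at h
    split_ifs at h with e
    · subst e
      have hx : Γ y = [] := DV_rel (.lam y M) (by simp [fvV]) _ _ _ _ h
      exact ⟨n, Γ, w, 0, 0, h, by rw [hx]; exact ⟨rfl, rfl, rfl⟩, (update_self hx).symm, by simp⟩
    · simp only [DV] at h ⊢
      exact LamD_anti e (fun n Γ w b => DT_anti hL M n Γ w b) _ _ _ _ h
theorem DT_anti {x z : ℕ} {L : Tm} (hL : fvV (.lam z L) = ∅) : ∀ (M : Tm) (n Γ w b),
    DT Unit01 (substT M x (.lam z L)) n Γ w b → ∃ n1 Γ1 w1 m v, DT Unit01 M n1 Γ1 w1 b ∧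
    LamD Unit01 (DT Unit01 L) z (Γ1 x) m emptyCtx v ∧ Γ = Function.update Γ1 x [] ∧ w = w1 + v
  | .val V, n, Γ, w, b, h => by
    simp only [substT, DT] at h
    rcases h with ⟨rfl, rfl, rfl, rfl⟩ | ⟨A, rfl, h⟩
    · exact ⟨0, emptyCtx, 0, 0, 0, DT_zero _ _, ⟨rfl, rfl, rfl⟩, by simp, by simp⟩
    · obtain ⟨n1, Γ1, w1, m, v, h1, h2⟩ := DV_anti hL V _ _ _ _ h
      exact ⟨n1, Γ1, w1, m, v, Or.inr ⟨A, rfl, h1⟩, h2⟩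
  | .app V W, n, Γ, w, b, h => by
    simp only [substT, DT] at h
    rcases h with ⟨rfl, rfl, rfl, rfl⟩ | ⟨A, n1, Γ1, w1, n2, Γ2, w2, h1, h2, rfl, rfl, rfl⟩
    · exact ⟨0, emptyCtx, 0, 0, 0, DT_zero _ _, ⟨rfl, rfl, rfl⟩, by simp, by simp⟩
    · obtain ⟨k1, Δ1, u1, m1, v1, ha, hb, rfl, rfl⟩ := DV_anti hL V _ _ _ _ h1
      obtain ⟨k2, Δ2, u2, m2, v2, hc, hd, rfl, rfl⟩ := DV_anti hL W _ _ _ _ h2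
      refine ⟨_, _, _, m1 + m2, v1 + v2, Or.inr ⟨A, _, _, _, _, _, _, ha, hc, rfl, rfl, rfl⟩,
        ?_, (update_union _ _ _).symm, by ring⟩
      simpa [ctxUnion] using LamD_append hb hd
  | .choice M N, n, Γ, w, b, h => by
    simp only [substT, DT] at h
    rcases h with ⟨rfl, rfl, rfl, rfl⟩ |
      ⟨n1, Γ1, w1, b1, n2, Γ2, w2, b2, h1, h2, rfl, rfl, rfl, rfl⟩
    · exact ⟨0, emptyCtx, 0, 0, 0, DT_zero _ _, ⟨rfl, rfl, rfl⟩, by simp, by simp⟩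
    · obtain ⟨k1, Δ1, u1, m1, v1, ha, hb, rfl, rfl⟩ := DT_anti hL M _ _ _ _ h1
      obtain ⟨k2, Δ2, u2, m2, v2, hc, hd, rfl, rfl⟩ := DT_anti hL N _ _ _ _ h2
      refine ⟨_, _, _, m1 + m2, 1/2 * v1 + 1/2 * v2,
        Or.inr ⟨_, _, _, _, _, _, _, _, ha, hc, rfl, rfl, rfl, rfl⟩,
        ?_, by rw [update_union, update_scale, update_scale], by ring⟩
      simpa [ctxUnion, scaleC] using LamD_append (LamD_scale (Unit01_mul half01) hb)
        (LamD_scale (Unit01_mul half01) hd)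
  | .letin y N M, n, Γ, w, b, h => by
    simp only [substT, DT] at h
    rcases h with ⟨rfl, rfl, rfl, rfl⟩ | ⟨a, n1, Γ1, w1, n2, Γ2, w2, h1, h2, rfl, rfl, rfl⟩
    · exact ⟨0, emptyCtx, 0, 0, 0, DT_zero _ _, ⟨rfl, rfl, rfl⟩, by simp, by simp⟩
    · obtain ⟨k1, Δ1, u1, m1, v1, ha, hb, rfl, rfl⟩ := DT_anti hL N _ _ _ _ h1
      have : ∃ n1 Γ1 w1 m v, LetD Unit01 (DT Unit01 M) y a n1 Γ1 w1 b ∧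
          LamD Unit01 (DT Unit01 L) z (Γ1 x) m emptyCtx v ∧
          Γ2 = Function.update Γ1 x [] ∧ w2 = w1 + v := by
        split_ifs at h2 with e
        · subst e
          have hx : Γ2 y = [] := LetD_rel (fun e => absurd rfl e) _ _ _ _ _ h2
          exact ⟨n2, Γ2, w2, 0, 0, h2, by rw [hx]; exact ⟨rfl, rfl, rfl⟩,
            (update_self hx).symm, by simp⟩
        · exact LetD_anti e (fun n Γ w b => DT_anti hL M n Γ w b) _ _ _ _ _ h2
      obtain ⟨k2, Δ2, u2, m2, v2, hc, hd, rfl, rfl⟩ := this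
      refine ⟨_, _, _, m1 + m2, v1 + v2, Or.inr ⟨a, _, _, _, _, _, _, ha, hc, rfl, rfl, rfl⟩,
        ?_, by rw [update_union], by ring⟩
      simpa [ctxUnion] using LamD_append hb hd
end

/-! ### Reduction -/

inductive R1 : Tm → Tm → Prop
  | beta (x : ℕ) (M : Tm) (V : Val) : R1 (.app (.lam x M) V) (substT M x V)
  | letval (x : ℕ) (V : Val) (M : Tm) : R1 (.letin x (.val V) M) (substT M x V)
  | letstep {N N' : Tm} (x : ℕ) (M : Tm) : R1 N N' → R1 (.letin x N M) (.letin x N' M)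

inductive R2 : Tm → Tm → Tm → Prop
  | choice (M N : Tm) : R2 (.choice M N) M N
  | letstep {N N1 N2 : Tm} (x : ℕ) (M : Tm) : R2 N N1 N2 →
      R2 (.letin x N M) (.letin x N1 M) (.letin x N2 M)

theorem step_cases : ∀ (M : Tm), fvT M = ∅ → M.isVal = false →
    (∃ M', R1 M M' ∧ stepF M = {(1, M')}) ∨
    (∃ M1 M2, R2 M M1 M2 ∧ stepF M = {(1/2, M1), (1/2, M2)})
  | .val V, _, h => by simp [Tm.isVal] at h
  | .app (.var y) W, hc, _ => by
    exfalso
    have : y ∈ fvT (.app (.var y) W) := by simp [fvT, fvV]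
    rw [hc] at this; simp at this
  | .app (.lam x M) W, _, _ => Or.inl ⟨_, .beta _ _ _, by simp [stepF]⟩
  | .choice M N, _, _ => Or.inr ⟨_, _, .choice _ _, by simp [stepF]⟩
  | .letin x (.val V) M, _, _ => Or.inl ⟨_, .letval _ _ _, by simp [stepF]⟩
  | .letin x (.app V W) M, hc, _ => by
    rcases step_cases (.app V W) (by simp only [fvT, Finset.union_eq_empty] at hc ⊢; exact hc.1) rfl
      with ⟨M', h1, h2⟩ | ⟨M1, M2, h1, h2⟩
    · exact Or.inl ⟨_, .letstep _ _ h1, by simp [stepF, h2]⟩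
    · exact Or.inr ⟨_, _, .letstep _ _ h1, by simp [stepF, h2]⟩
  | .letin x (.choice V W) M, _, _ => Or.inr ⟨_, _, .letstep _ _ (.choice _ _), by simp [stepF]⟩
  | .letin x (.letin y V W) M, hc, _ => by
    rcases step_cases (.letin y V W)
      (by simp only [fvT, Finset.union_eq_empty] at hc ⊢; exact hc.1) rfl
      with ⟨M', h1, h2⟩ | ⟨M1, M2, h1, h2⟩
    · exact Or.inl ⟨_, .letstep _ _ h1, by rw [stepF]; simp [h2]; simp⟩
    · exact Or.inr ⟨_, _, .letstep _ _ h1, by rw [stepF]; simp [h2]; simp⟩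

mutual
theorem fvV_subst {x : ℕ} {V : Val} (hV : fvV V = ∅) : ∀ (W : Val) (y : ℕ),
    y ∈ fvV (substV W x V) → y ∈ fvV W ∧ y ≠ x
  | .var z, y, h => by
    simp only [substV] at h
    split_ifs at h with e
    · simp [hV] at h
    · simp only [fvV, Finset.mem_singleton] at h ⊢
      subst h; exact ⟨rfl, e⟩
  | .lam z M, y, h => by
    simp only [substV] at h
    split_ifs at h with e
    · simp only [fvV, Finset.mem_sdiff, Finset.mem_singleton] at h ⊢
      subst e; exact ⟨h, h.2⟩
    · simp only [fvV, Finset.mem_sdiff, Finset.mem_singleton] at h ⊢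
      have := fvT_subst hV M y h.1
      exact ⟨⟨this.1, h.2⟩, this.2⟩
theorem fvT_subst {x : ℕ} {V : Val} (hV : fvV V = ∅) : ∀ (M : Tm) (y : ℕ),
    y ∈ fvT (substT M x V) → y ∈ fvT M ∧ y ≠ x
  | .val W, y, h => by
    simp only [substT, fvT] at h ⊢
    exact fvV_subst hV W y h
  | .app W U, y, h => by
    simp only [substT, fvT, Finset.mem_union] at h ⊢
    rcases h with h | h
    · have := fvV_subst hV W y h; exact ⟨Or.inl this.1, this.2⟩
    · have := fvV_subst hV U y h; exact ⟨Or.inr this.1, this.2⟩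
  | .choice W U, y, h => by
    simp only [substT, fvT, Finset.mem_union] at h ⊢
    rcases h with h | h
    · have := fvT_subst hV W y h; exact ⟨Or.inl this.1, this.2⟩
    · have := fvT_subst hV U y h; exact ⟨Or.inr this.1, this.2⟩
  | .letin z N M, y, h => by
    simp only [substT, fvT, Finset.mem_union, Finset.mem_sdiff, Finset.mem_singleton] at h ⊢
    rcases h with h | h
    · have := fvT_subst hV N y h; exact ⟨Or.inl this.1, this.2⟩
    · split_ifs at h with e
      · subst e; exact ⟨Or.inr h, h.2⟩
      · have := fvT_subst hV M y h.1; exact ⟨Or.inr ⟨this.1, h.2⟩, this.2⟩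
end

theorem closed_subst {x : ℕ} {V : Val} {M : Tm} (hV : fvV V = ∅) (hM : fvT M \ {x} = ∅) :
    fvT (substT M x V) = ∅ := by
  apply Finset.eq_empty_of_forall_notMem
  intro y hy
  have := fvT_subst hV M y hy
  have h2 : y ∈ fvT M \ {x} := by simpa using this
  simp [hM] at h2

theorem R1.closed {M M' : Tm} (h : R1 M M') (hc : fvT M = ∅) : fvT M' = ∅ := by
  induction h with
  | beta x M V =>
    simp only [fvT, fvV, Finset.union_eq_empty] at hc
    exact closed_subst hc.2 hc.1
  | letval x V M =>
    simp only [fvT, Finset.union_eq_empty] at hc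
    exact closed_subst hc.1 hc.2
  | letstep x M h ih =>
    simp only [fvT, Finset.union_eq_empty] at hc ⊢
    exact ⟨ih hc.1, hc.2⟩

theorem R2.closed {M M1 M2 : Tm} (h : R2 M M1 M2) (hc : fvT M = ∅) :
    fvT M1 = ∅ ∧ fvT M2 = ∅ := by
  induction h with
  | choice M N => simpa only [fvT, Finset.union_eq_empty] using hc
  | letstep x M h ih =>
    simp only [fvT, Finset.union_eq_empty] at hc ⊢
    exact ⟨⟨(ih hc.1).1, hc.2⟩, ⟨(ih hc.1).2, hc.2⟩⟩

theorem closed_lam {V : Val} (hV : fvV V = ∅) : ∃ z L, V = .lam z L := by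
  cases V with
  | var y => simp [fvV] at hV
  | lam z L => exact ⟨z, L, rfl⟩

/-! ### Subject reduction -/

theorem R1.sr {M M' : Tm} (h : R1 M M') : ∀ {n w b}, fvT M = ∅ → DT Any M n emptyCtx w b →
    (w = 0 ∧ b = []) ∨ ∃ n' w', n' < n ∧ DT Any M' n' emptyCtx w' b ∧ w = w' + 1 := by
  induction h with
  | beta x M V =>
    intro n w b hc h
    simp only [fvT, Finset.union_eq_empty] at hc
    obtain ⟨z, L, rfl⟩ := closed_lam hc.2
    simp only [DT, DV] at h
    rcases h with h | ⟨A, n1, Γ1, w1, n2, Γ2, w2, h1, h2, rfl, hΓ, rfl⟩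
    · exact Or.inl h.2.2
    right
    obtain ⟨rfl, rfl⟩ := (union_eq_empty _ _).1 hΓ.symm
    obtain ⟨n1, Γ1, w1, b', _, _, _, -, h3, hA, ⟨rfl, rfl, rfl⟩, rfl, hΓ1, rfl⟩ := h1
    cases hA
    simp only [scaleC_one, union_empty] at hΓ1
    refine ⟨n1 + n2, w1 + w2, by omega, ?_, by ring⟩
    rw [hΓ1]
    exact DT_sub M _ _ _ _ _ _ h3 h2
  | letval x V M =>
    intro n w b hc h
    simp only [fvT, Finset.union_eq_empty] at hc
    obtain ⟨z, L, rfl⟩ := closed_lam hc.1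
    simp only [DT, DV] at h
    rcases h with h | ⟨a, n1, Γ1, w1, n2, Γ2, w2, h1, h2, rfl, hΓ, rfl⟩
    · exact Or.inl h.2.2
    right
    obtain ⟨rfl, rfl⟩ := (union_eq_empty _ _).1 hΓ.symm
    rcases h1 with ⟨rfl, -, rfl, rfl⟩ | ⟨A, rfl, h1⟩
    · obtain ⟨rfl, -, rfl, rfl⟩ := h2
      exact ⟨0, 0, by omega, DT_zero _ _, by ring⟩
    · obtain ⟨n3, Γ3, w3, b3, _, _, _, _, -, h3, hA, ⟨rfl, rfl, rfl, rfl⟩, hn, hΓ1, rfl, rfl⟩ := h2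
      subst hA
      simp only [scaleC_one, union_empty] at hΓ1
      refine ⟨n3 + n1, w3 + w1, by omega, ?_, by ring⟩
      rw [hΓ1]
      simpa using DT_sub M _ _ _ _ _ _ h3 h1
  | @letstep N N' x M hN ih =>
    intro n w b hc h
    simp only [fvT, Finset.union_eq_empty] at hc
    simp only [DT] at h
    rcases h with h | ⟨a, n1, Γ1, w1, n2, Γ2, w2, h1, h2, rfl, hΓ, rfl⟩
    · exact Or.inl h.2.2
    right
    obtain ⟨rfl, rfl⟩ := (union_eq_empty _ _).1 hΓ.symm
    rcases ih hc.1 h1 with ⟨rfl, rfl⟩ | ⟨n', w', hn, h3, rfl⟩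
    · obtain ⟨rfl, -, rfl, rfl⟩ := h2
      exact ⟨0, 0, by omega, DT_zero _ _, by ring⟩
    · exact ⟨n' + n2 + 1, w2 + w' + 1, by omega,
        Or.inr ⟨a, _, _, _, _, _, _, h3, h2, rfl, by simp, rfl⟩, by ring⟩

theorem R2.sr {M M1 M2 : Tm} (h : R2 M M1 M2) : ∀ {n w b}, DT Any M n emptyCtx w b →
    (w = 0 ∧ b = []) ∨ ∃ n1 w1 b1 n2 w2 b2, n1 < n ∧ n2 < n ∧ DT Any M1 n1 emptyCtx w1 b1 ∧
      DT Any M2 n2 emptyCtx w2 b2 ∧ w = w1 / 2 + w2 / 2 + 1 ∧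
      b = scaleL (1/2) b1 ++ scaleL (1/2) b2 := by
  induction h with
  | choice M N =>
    intro n w b h
    simp only [DT] at h
    rcases h with h | ⟨n1, Γ1, w1, b1, n2, Γ2, w2, b2, h1, h2, rfl, hΓ, rfl, rfl⟩
    · exact Or.inl h.2.2
    right
    obtain ⟨hΓ1, hΓ2⟩ := (union_eq_empty _ _).1 hΓ.symm
    rw [scaleC_eq_empty] at hΓ1 hΓ2
    subst hΓ1 hΓ2
    exact ⟨n1, w1, b1, n2, w2, b2, by omega, by omega, h1, h2, rfl, rfl⟩
  | @letstep N N1 N2 x M hN ih =>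
    intro n w b h
    simp only [DT] at h
    rcases h with h | ⟨a, n1, Γ1, w1, n2, Γ2, w2, h1, h2, rfl, hΓ, rfl⟩
    · exact Or.inl h.2.2
    right
    obtain ⟨rfl, rfl⟩ := (union_eq_empty _ _).1 hΓ.symm
    rcases ih h1 with ⟨rfl, rfl⟩ | ⟨m1, v1, a1, m2, v2, a2, hm1, hm2, h3, h4, rfl, rfl⟩
    · obtain ⟨rfl, -, rfl, rfl⟩ := h2
      exact ⟨0, 0, [], 0, 0, [], by omega, by omega, DT_zero _ _, DT_zero _ _, by ring, by simp⟩
    · obtain ⟨k1, u1, b1, k2, u2, b2, ha, hb, rfl, rfl, rfl⟩ := LetD_split h2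
      obtain ⟨u1, b1, ha', rfl, rfl⟩ := LetD_unscale ha
      obtain ⟨u2, b2, hb', rfl, rfl⟩ := LetD_unscale hb
      exact ⟨m1 + k1 + 1, u1 + v1 + 1, b1, m2 + k2 + 1, u2 + v2 + 1, b2, by omega, by omega,
        Or.inr ⟨_, _, _, _, _, _, _, h3, ha', rfl, by simp, rfl⟩,
        Or.inr ⟨_, _, _, _, _, _, _, h4, hb', rfl, by simp, rfl⟩, by ring, rfl⟩

/-! ### Subject expansion -/

theorem one01 : Unit01 1 := by constructor <;> norm_num

theorem R1.se {M M' : Tm} (h : R1 M M') : ∀ {n w b}, fvT M = ∅ → DT Unit01 M' n emptyCtx w b →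
    ∃ n' w', DT Unit01 M n' emptyCtx w' b ∧ w + 1 ≤ w' := by
  induction h with
  | beta x M V =>
    intro n w b hc h
    simp only [fvT, Finset.union_eq_empty] at hc
    obtain ⟨z, L, rfl⟩ := closed_lam hc.2
    obtain ⟨n1, Γ1, w1, m, v, h1, h2, h3, rfl⟩ := DT_anti hc.2 M _ _ _ _ h
    refine ⟨_, w1 + 1 + v, Or.inr ⟨Γ1 x, n1 + 1, emptyCtx, w1 + 1, m, emptyCtx, v,
      ⟨n1, Γ1, w1, b, 0, emptyCtx, 0, one01, h1, rfl, ⟨rfl, rfl, rfl⟩, rfl, ?_, by ring⟩,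
      h2, rfl, by simp, rfl⟩, by linarith⟩
    rw [← h3]; simp
  | letval x V M =>
    intro n w b hc h
    simp only [fvT, Finset.union_eq_empty] at hc
    obtain ⟨z, L, rfl⟩ := closed_lam hc.1
    obtain ⟨n1, Γ1, w1, m, v, h1, h2, h3, rfl⟩ := DT_anti hc.1 M _ _ _ _ h
    refine ⟨_, w1 + v + 1, Or.inr ⟨[(1, Γ1 x)], m, emptyCtx, v, n1, emptyCtx, w1,
      Or.inr ⟨_, rfl, h2⟩,
      ⟨n1, Γ1, w1, b, 0, emptyCtx, 0, [], one01, h1, rfl, ⟨rfl, rfl, rfl, rfl⟩, rfl, ?_,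
        by ring, by simp⟩,
      rfl, by simp, rfl⟩, le_rfl⟩
    rw [← h3]; simp
  | @letstep N N' x M hN ih =>
    intro n w b hc h
    simp only [fvT, Finset.union_eq_empty] at hc
    simp only [DT] at h
    rcases h with ⟨rfl, -, rfl, rfl⟩ | ⟨a, n1, Γ1, w1, n2, Γ2, w2, h1, h2, rfl, hΓ, rfl⟩
    · exact ⟨_, _, Or.inr ⟨[], _, _, _, _, _, _, DT_zero _ _, ⟨rfl, rfl, rfl, rfl⟩, rfl,
        by simp, rfl⟩, by simp⟩
    · obtain ⟨rfl, rfl⟩ := (union_eq_empty _ _).1 hΓ.symm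
      obtain ⟨n', w', h3, h4⟩ := ih hc.1 h1
      exact ⟨_, _, Or.inr ⟨a, _, _, _, _, _, _, h3, h2, rfl, by simp, rfl⟩, by linarith⟩

theorem let_norm {x N M n w b} (h : DT Unit01 (.letin x N M) n emptyCtx w b) :
    ∃ a n1 w1 n2 w2, DT Unit01 N n1 emptyCtx w1 a ∧
      LetD Unit01 (DT Unit01 M) x a n2 emptyCtx w2 b ∧ w ≤ w2 + w1 + 1 := by
  simp only [DT] at h
  rcases h with ⟨rfl, -, rfl, rfl⟩ | ⟨a, n1, Γ1, w1, n2, Γ2, w2, h1, h2, rfl, hΓ, rfl⟩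
  · exact ⟨[], 0, 0, 0, 0, DT_zero _ _, ⟨rfl, rfl, rfl, rfl⟩, by norm_num⟩
  · obtain ⟨rfl, rfl⟩ := (union_eq_empty _ _).1 hΓ.symm
    exact ⟨a, n1, w1, n2, w2, h1, h2, le_rfl⟩

theorem R2.se {M M1 M2 : Tm} (h : R2 M M1 M2) : ∀ {n1 w1 b1 n2 w2 b2},
    DT Unit01 M1 n1 emptyCtx w1 b1 → DT Unit01 M2 n2 emptyCtx w2 b2 →
    ∃ n' w', DT Unit01 M n' emptyCtx w' (scaleL (1/2) b1 ++ scaleL (1/2) b2) ∧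
      w1 / 2 + w2 / 2 + 1 ≤ w' := by
  induction h with
  | choice M N =>
    intro n1 w1 b1 n2 w2 b2 h1 h2
    exact ⟨_, _, Or.inr ⟨_, _, _, _, _, _, _, _, h1, h2, rfl, by simp, rfl, rfl⟩, le_rfl⟩
  | @letstep N N1 N2 x M hN ih =>
    intro n1 w1 b1 n2 w2 b2 h1 h2
    obtain ⟨a1, m1, v1, k1, u1, h3, h4, h5⟩ := let_norm h1
    obtain ⟨a2, m2, v2, k2, u2, h6, h7, h8⟩ := let_norm h2
    obtain ⟨n', w', h9, h10⟩ := ih h3 h6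
    have := LetD_append (LetD_scale (Unit01_mul half01) h4) (LetD_scale (Unit01_mul half01) h7)
    exact ⟨_, _, Or.inr ⟨_, _, _, _, _, _, _, h9, this, rfl, by simp, rfl⟩, by linarith⟩

/-! ### Evaluation -/

theorem scaleM_add (p : ℚ) (m m' : MDist) : scaleM p (m + m') = scaleM p m + scaleM p m' := by
  simp [scaleM]
theorem scaleM_mul (p q : ℚ) (m : MDist) : scaleM p (scaleM q m) = scaleM (p * q) m := by
  simp [scaleM, mul_assoc]
theorem mstepF_add (m m' : MDist) : mstepF (m + m') = mstepF m + mstepF m' := by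
  simp [mstepF]
theorem mstepF_scale (p : ℚ) (m : MDist) : mstepF (scaleM p m) = scaleM p (mstepF m) := by
  induction m using Multiset.induction_on with
  | empty => rfl
  | cons a s ih =>
    rw [← Multiset.singleton_add, scaleM_add, mstepF_add, ih, mstepF_add, scaleM_add]
    congr 1
    simp [mstepF, scaleM, mul_assoc]
theorem normV_add (m m' : MDist) : normV (m + m') = normV m + normV m' := by
  simp [normV]
theorem normV_scale (p : ℚ) (m : MDist) : normV (scaleM p m) = p * normV m := by
  induction m using Multiset.induction_on with
  | empty => simp [normV, scaleM]
  | cons a s ih =>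
    rw [← Multiset.singleton_add, scaleM_add, normV_add, ih, normV_add, mul_add]
    congr 1
    by_cases h : a.2.isVal = true
    · simp [normV, scaleM, h, Multiset.filter_singleton]
    · simp [normV, scaleM, h, Multiset.filter_singleton]

theorem iter_add (k : ℕ) : ∀ m m' : MDist,
    mstepF^[k] (m + m') = mstepF^[k] m + mstepF^[k] m' := by
  induction k with
  | zero => intro m m'; rfl
  | succ k ih => intro m m'; simp only [Function.iterate_succ_apply, mstepF_add, ih]
theorem iter_scale (k : ℕ) (p : ℚ) : ∀ m : MDist,
    mstepF^[k] (scaleM p m) = scaleM p (mstepF^[k] m) := by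
  induction k with
  | zero => intro m; rfl
  | succ k ih => intro m; simp only [Function.iterate_succ_apply, mstepF_scale, ih]

theorem iter_single (k : ℕ) (p : ℚ) (M : Tm) : normV (mstepF^[k] {(p, M)}) = p * evalP k M := by
  have : ({(p, M)} : MDist) = scaleM p {(1, M)} := by simp [scaleM]
  rw [this, iter_scale, normV_scale]; rfl

theorem evalP_succ (k : ℕ) (M : Tm) : evalP (k + 1) M = normV (mstepF^[k] (stepF M)) := by
  have : mstepF {(1, M)} = stepF M := by simp [mstepF, scaleM]
  rw [evalP, traj, Function.iterate_succ_apply, this]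

theorem evalP_val (k : ℕ) (V : Val) : evalP k (.val V) = 1 := by
  induction k with
  | zero =>
    have hv : (Tm.val V).isVal = true := rfl
    simp [evalP, traj, normV, Multiset.filter_singleton, hv]
  | succ k ih => rw [evalP_succ, stepF, iter_single, ih]; norm_num

theorem evalP_zero {M : Tm} (h : M.isVal = false) : evalP 0 M = 0 := by
  simp [evalP, traj, normV, Multiset.filter_singleton, h]

theorem evalP_one {M M' : Tm} (h : stepF M = {(1, M')}) (k : ℕ) :
    evalP (k + 1) M = evalP k M' := by
  rw [evalP_succ, h, iter_single, one_mul]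

theorem evalP_two {M M1 M2 : Tm} (h : stepF M = {(1/2, M1), (1/2, M2)}) (k : ℕ) :
    evalP (k + 1) M = evalP k M1 / 2 + evalP k M2 / 2 := by
  have : ({(1/2, M1), (1/2, M2)} : MDist) = {(1/2, M1)} + {(1/2, M2)} := rfl
  rw [evalP_succ, h, this, iter_add, normV_add, iter_single, iter_single]; ring

theorem isVal_true {M : Tm} (h : M.isVal = true) : ∃ V, M = .val V := by
  cases M <;> simp_all [Tm.isVal]

theorem evalP_bounds (k : ℕ) : ∀ M : Tm, fvT M = ∅ →
    0 ≤ evalP k M ∧ evalP k M ≤ 1 ∧ evalP k M ≤ evalP (k + 1) M := by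
  induction k with
  | zero =>
    intro M hM
    cases hv : M.isVal with
    | true =>
      obtain ⟨V, rfl⟩ := isVal_true hv
      simp [evalP_val]
    | false =>
      rw [evalP_zero hv]
      refine ⟨le_rfl, zero_le_one, ?_⟩
      have h0 : ∀ M, 0 ≤ evalP 0 M := by
        intro M
        cases hv : M.isVal with
        | true =>
          obtain ⟨V, rfl⟩ := isVal_true hv
          simp [evalP_val]
        | false => rw [evalP_zero hv]
      rcases step_cases M hM hv with ⟨M', h1, h2⟩ | ⟨M1, M2, h1, h2⟩
      · rw [evalP_one h2]; exact h0 _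
      · rw [evalP_two h2]
        have := h0 M1; have := h0 M2; linarith
  | succ k ih =>
    intro M hM
    cases hv : M.isVal with
    | true =>
      obtain ⟨V, rfl⟩ := isVal_true hv
      simp [evalP_val]
    | false =>
      rcases step_cases M hM hv with ⟨M', h1, h2⟩ | ⟨M1, M2, h1, h2⟩
      · rw [evalP_one h2, evalP_one h2]; exact ih _ (h1.closed hM)
      · rw [evalP_two h2, evalP_two h2]
        have h3 := ih _ (h1.closed hM).1
        have h4 := ih _ (h1.closed hM).2
        refine ⟨?_, ?_, ?_⟩ <;> linarith [h3.1, h4.1, h3.2.1, h4.2.1, h3.2.2, h4.2.2]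

theorem evalP_mono {M : Tm} (hM : fvT M = ∅) : Monotone fun k => evalP k M :=
  monotone_nat_of_le_succ fun k => (evalP_bounds k M hM).2.2

theorem etime_mono {M : Tm} (hM : fvT M = ∅) : Monotone fun k => etime k M :=
  monotone_nat_of_le_succ fun k => by
    simp only [etime, Finset.sum_range_succ]
    linarith [(evalP_bounds k M hM).2.1]

theorem etime_val (k : ℕ) (V : Val) : etime k (.val V) = 0 := by
  simp [etime, evalP_val]

theorem etime_one {M M' : Tm} (hv : M.isVal = false) (h : stepF M = {(1, M')}) (k : ℕ) :
    etime (k + 1) M = etime k M' + 1 := by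
  simp only [etime, Finset.sum_range_succ', evalP_one h, evalP_zero hv]; ring

theorem etime_two {M M1 M2 : Tm} (hv : M.isVal = false)
    (h : stepF M = {(1/2, M1), (1/2, M2)}) (k : ℕ) :
    etime (k + 1) M = etime k M1 / 2 + etime k M2 / 2 + 1 := by
  simp only [etime, Finset.sum_range_succ', evalP_two h, evalP_zero hv, Finset.sum_div,
    ← Finset.sum_add_distrib]
  congr 1
  · apply Finset.sum_congr rfl; intros; ring
  · ring

/-! ### Soundness and completeness -/

theorem normD_scale (p : ℚ) (b : DTy) : normD (scaleL p b) = p * normD b := by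
  induction b with
  | nil => simp [normD]
  | cons a b ih => simp only [normD, scaleL_cons, List.map_cons, List.sum_cons] at ih ⊢; rw [ih]; ring
theorem normD_append (a b : DTy) : normD (a ++ b) = normD a + normD b := by simp [normD]
theorem tight_append (a b : DTy) : Tight (a ++ b) ↔ Tight a ∧ Tight b := by
  simp only [Tight, List.mem_append, or_imp, forall_and]
theorem tight_scale (p : ℚ) (b : DTy) : Tight (scaleL p b) ↔ Tight b := by
  simp only [Tight, scaleL, List.forall_mem_map]

theorem sound (n : ℕ) : ∀ M w b, fvT M = ∅ → DT Any M n emptyCtx w b → Tight b →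
    ∃ k, normD b ≤ evalP k M ∧ w ≤ etime k M := by
  induction n using Nat.strong_induction_on with
  | _ n ih =>
    intro M w b hM h hb
    have zero_case : w = 0 ∧ b = [] → ∃ k, normD b ≤ evalP k M ∧ w ≤ etime k M := by
      rintro ⟨rfl, rfl⟩
      exact ⟨0, by simpa [normD] using (evalP_bounds 0 M hM).1, by simp [etime]⟩
    cases hv : M.isVal with
    | true =>
      obtain ⟨V, rfl⟩ := isVal_true hv
      simp only [DT] at h
      rcases h with h | ⟨A, rfl, h⟩
      · exact zero_case h.2.2
      · have : A = [] := hb (1, A) (by simp)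
        subst this
        obtain ⟨z, L, rfl⟩ := closed_lam hM
        obtain ⟨-, -, rfl⟩ := h
        exact ⟨0, by simp [normD, evalP_val], by simp [etime]⟩
    | false =>
      rcases step_cases M hM hv with ⟨M', h1, h2⟩ | ⟨M1, M2, h1, h2⟩
      · rcases h1.sr hM h with h | ⟨n', w', hn, h3, rfl⟩
        · exact zero_case h
        · obtain ⟨k, hk1, hk2⟩ := ih n' hn _ _ _ (h1.closed hM) h3 hb
          exact ⟨k + 1, by rwa [evalP_one h2], by rw [etime_one hv h2]; linarith⟩
      · rcases h1.sr h with h | ⟨n1, w1, b1, n2, w2, b2, hn1, hn2, h3, h4, rfl, rfl⟩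
        · exact zero_case h
        · rw [tight_append, tight_scale, tight_scale] at hb
          have hc := h1.closed hM
          obtain ⟨k1, ha1, ha2⟩ := ih n1 hn1 _ _ _ hc.1 h3 hb.1
          obtain ⟨k2, hb1, hb2⟩ := ih n2 hn2 _ _ _ hc.2 h4 hb.2
          have e1 := evalP_mono hc.1 (le_max_left k1 k2)
          have e2 := evalP_mono hc.2 (le_max_right k1 k2)
          have t1 := etime_mono hc.1 (le_max_left k1 k2)
          have t2 := etime_mono hc.2 (le_max_right k1 k2)
          simp only at e1 e2 t1 t2
          refine ⟨max k1 k2 + 1, ?_, ?_⟩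
          · rw [evalP_two h2, normD_append, normD_scale, normD_scale]; linarith
          · rw [etime_two hv h2]; linarith

theorem complete (k : ℕ) : ∀ M, fvT M = ∅ → ∃ n w b, DT Unit01 M n emptyCtx w b ∧ Tight b ∧
    normD b = evalP k M ∧ etime k M ≤ w := by
  have val_case : ∀ k V, fvT (.val V) = ∅ → ∃ n w b, DT Unit01 (.val V) n emptyCtx w b ∧ Tight b ∧
      normD b = evalP k (.val V) ∧ etime k (.val V) ≤ w := by
    intro k V hV
    obtain ⟨z, L, rfl⟩ := closed_lam hV
    exact ⟨0, 0, [(1, [])], Or.inr ⟨[], rfl, ⟨rfl, rfl, rfl⟩⟩, by simp [Tight],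
      by simp [normD, evalP_val], by simp [etime_val]⟩
  induction k with
  | zero =>
    intro M hM
    cases hv : M.isVal with
    | true =>
      obtain ⟨V, rfl⟩ := isVal_true hv
      exact val_case _ _ hM
    | false =>
      exact ⟨0, 0, [], DT_zero _ _, by simp [Tight], by simp [normD, evalP_zero hv], by simp [etime]⟩
  | succ k ih =>
    intro M hM
    cases hv : M.isVal with
    | true =>
      obtain ⟨V, rfl⟩ := isVal_true hv
      exact val_case _ _ hM
    | false =>
      rcases step_cases M hM hv with ⟨M', h1, h2⟩ | ⟨M1, M2, h1, h2⟩
      · obtain ⟨n, w, b, ha, hb, hc, hd⟩ := ih M' (h1.closed hM)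
        obtain ⟨n', w', he, hf⟩ := h1.se hM ha
        exact ⟨n', w', b, he, hb, by rw [hc, evalP_one h2], by rw [etime_one hv h2]; linarith⟩
      · obtain ⟨n, w, b, ha, hb, hc, hd⟩ := ih M1 (h1.closed hM).1
        obtain ⟨m, v, c, ia, ib, ic, id⟩ := ih M2 (h1.closed hM).2
        obtain ⟨n', w', he, hf⟩ := h1.se ha ia
        exact ⟨n', w', _, he, (tight_append _ _).2 ⟨(tight_scale _ _).2 hb, (tight_scale _ _).2 ib⟩,
          by rw [normD_append, normD_scale, normD_scale, hc, ic, evalP_two h2]; ring,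
          by rw [etime_two hv h2]; linarith⟩

/-! ### Relating the two presentations of typing -/

def Conv (Γ : Ctx) (w : ℚ) (M : Tm) : Ty → Prop
  | .dist b => ∃ n, DT Any M n Γ w b
  | .inter A => ∃ V n, M = .val V ∧ DV Any V A n Γ w
  | .arrow T => ∃ x P n Γ' w' b, M = .val (.lam x P) ∧ T = .arr (Γ' x) b ∧ DT Any P n Γ' w' b ∧
      Γ = Function.update Γ' x [] ∧ w = w' + 1

theorem conv_bang (V : Val) : ∀ (I : List (ℚ × Ctx × ℚ × ATy)),
    (∀ k ∈ I, Conv k.2.1 k.2.2.1 (.val V) (.arrow k.2.2.2)) →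
    ∃ n, DV Any V (I.map fun k => (k.1, k.2.2.2)) n
      (fun y => (I.map fun k => scaleL k.1 (k.2.1 y)).flatten) ((I.map fun k => k.1 * k.2.2.1).sum)
  | [], _ => by
    cases V with
    | var y => exact ⟨0, (update_empty y).symm, rfl, rfl⟩
    | lam x M => exact ⟨0, rfl, rfl, rfl⟩
  | k :: I, h => by
    obtain ⟨n, ih⟩ := conv_bang V I (fun k hk => h k (List.mem_cons_of_mem _ hk))
    obtain ⟨x, P, m, Γ', w', b, h1, h2, h3, h4, h5⟩ := h k List.mem_cons_self
    cases h1
    refine ⟨m + 1 + n, m, Γ', w', b, n, _, _, trivial, h3, h2, ih, rfl, ?_, ?_⟩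
    · rw [← h4]; rfl
    · rw [← h5]; simp

theorem conv_let (x : ℕ) (M : Tm) : ∀ (K : List (ℚ × ITy × Ctx × ℚ × DTy)),
    (∀ k ∈ K, k.2.2.1 x = []) →
    (∀ k ∈ K, ∃ n, DT Any M n (Function.update k.2.2.1 x k.2.1) k.2.2.2.1 k.2.2.2.2) →
    ∃ n, LetD Any (DT Any M) x (K.map fun k => (k.1, k.2.1)) n
      (fun y => (K.map fun k => scaleL k.1 (k.2.2.1 y)).flatten)
      ((K.map fun k => k.1 * k.2.2.2.1).sum) ((K.map fun k => scaleL k.1 k.2.2.2.2).flatten)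
  | [], _, _ => ⟨0, rfl, rfl, rfl, rfl⟩
  | k :: K, h, h' => by
    obtain ⟨n, ih⟩ := conv_let x M K (fun k hk => h k (List.mem_cons_of_mem _ hk))
      (fun k hk => h' k (List.mem_cons_of_mem _ hk))
    obtain ⟨m, h1⟩ := h' k List.mem_cons_self
    refine ⟨m + n, m, _, _, _, n, _, _, _, trivial, h1, by simp, ih, rfl, ?_, by simp, by simp⟩
    rw [Function.update_idem, update_self (h k List.mem_cons_self)]; rfl

theorem conv {Γ w M τ} (d : Deriv Γ w M τ) : Conv Γ w M τ := by
  induction d with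
  | var x A => exact ⟨.var x, 0, rfl, rfl, rfl, rfl⟩
  | zero M => exact ⟨0, DT_zero _ _⟩
  | lam x b d ih =>
    obtain ⟨n, h⟩ := ih
    exact ⟨x, _, n, _, _, b, rfl, rfl, h, rfl, rfl⟩
  | app d e ih1 ih2 =>
    obtain ⟨V, n, hV, h1⟩ := ih1
    obtain ⟨W, m, hW, h2⟩ := ih2
    cases hV; cases hW
    exact ⟨n + m, Or.inr ⟨_, _, _, _, _, _, _, h1, h2, rfl, rfl, rfl⟩⟩
  | choice d e ih1 ih2 =>
    obtain ⟨n, h1⟩ := ih1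
    obtain ⟨m, h2⟩ := ih2
    exact ⟨n + m + 1, Or.inr ⟨_, _, _, _, _, _, _, _, h1, h2, rfl, rfl, rfl, rfl⟩⟩
  | letin x K hx f d ih1 ih2 =>
    obtain ⟨n, h1⟩ := ih2
    obtain ⟨m, h2⟩ := conv_let x _ K hx (fun k hk => by
      obtain ⟨i, rfl⟩ := List.mem_iff_get.1 hk
      exact ih1 i)
    exact ⟨n + m + 1, Or.inr ⟨_, _, _, _, _, _, _, h1, h2, rfl, rfl, rfl⟩⟩
  | tval d ih =>
    obtain ⟨V, n, hV, h1⟩ := ih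
    cases hV
    exact ⟨n, Or.inr ⟨_, rfl, h1⟩⟩
  | bang I hI f ih =>
    obtain ⟨n, h⟩ := conv_bang _ I (fun k hk => by
      obtain ⟨i, rfl⟩ := List.mem_iff_get.1 hk
      exact ih i)
    exact ⟨_, n, rfl, h⟩

theorem LamD_list {P : TPred} {x : ℕ} {M : Tm}
    (hP : ∀ n Γ w b, P n Γ w b → Nonempty (Deriv Γ w M (.dist b))) :
    ∀ A n Γ w, LamD Unit01 P x A n Γ w → ∃ I : List (ℚ × Ctx × ℚ × ATy),
      (∀ k ∈ I, 0 < k.1 ∧ k.1 ≤ 1) ∧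
      (∀ k ∈ I, Nonempty (Deriv k.2.1 k.2.2.1 (.val (.lam x M)) (.arrow k.2.2.2))) ∧
      Γ = (fun y => (I.map fun k => scaleL k.1 (k.2.1 y)).flatten) ∧
      w = (I.map fun k => k.1 * k.2.2.1).sum ∧ A = I.map fun k => (k.1, k.2.2.2)
  | [], n, Γ, w, ⟨_, h2, h3⟩ => ⟨[], by simp, by simp, h2, h3, rfl⟩
  | (q, T) :: A, n, Γ, w,
      ⟨n1, Γ1, w1, b, n2, Γ2, w2, hQ, h1, hT, hL, hn, hΓ, hw⟩ => by
    obtain ⟨I, hI1, hI2, hI3, hI4, hI5⟩ := LamD_list hP A _ _ _ hL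
    obtain ⟨d⟩ := hP _ _ _ _ h1
    refine ⟨(q, Function.update Γ1 x [], w1 + 1, T) :: I, ?_, ?_, ?_, ?_, ?_⟩
    · exact List.forall_mem_cons.2 ⟨hQ, hI1⟩
    · refine List.forall_mem_cons.2 ⟨?_, hI2⟩
      subst hT
      exact ⟨.lam x b d⟩
    · rw [hΓ, hI3]; rfl
    · rw [hw, hI4]; simp
    · rw [hI5]; rfl

theorem LetD_list {P : TPred} {x : ℕ} {M : Tm}
    (hP : ∀ n Γ w b, P n Γ w b → Nonempty (Deriv Γ w M (.dist b))) :
    ∀ a n Γ w b, LetD Unit01 P x a n Γ w b → ∃ K : List (ℚ × ITy × Ctx × ℚ × DTy),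
      (∀ k ∈ K, k.2.2.1 x = []) ∧
      (∀ k ∈ K, Nonempty (Deriv (Function.update k.2.2.1 x k.2.1) k.2.2.2.1 M (.dist k.2.2.2.2))) ∧
      Γ = (fun y => (K.map fun k => scaleL k.1 (k.2.2.1 y)).flatten) ∧
      w = (K.map fun k => k.1 * k.2.2.2.1).sum ∧ a = (K.map fun k => (k.1, k.2.1)) ∧
      b = (K.map fun k => scaleL k.1 k.2.2.2.2).flatten
  | [], n, Γ, w, b, ⟨_, h2, h3, h4⟩ => ⟨[], by simp, by simp, h2, h3, rfl, h4⟩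
  | (q, T) :: A, n, Γ, w, b,
      ⟨n1, Γ1, w1, b1, n2, Γ2, w2, b2, hQ, h1, hT, hL, hn, hΓ, hw, hb⟩ => by
    obtain ⟨K, hI1, hI2, hI3, hI4, hI5, hI6⟩ := LetD_list hP A _ _ _ _ hL
    refine ⟨(q, T, Function.update Γ1 x [], w1, b1) :: K, ?_, ?_, ?_, ?_, ?_, ?_⟩
    · exact List.forall_mem_cons.2 ⟨by simp, hI1⟩
    · refine List.forall_mem_cons.2 ⟨?_, hI2⟩
      subst hT
      simpa using hP _ _ _ _ h1
    · rw [hΓ, hI3]; rfl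
    · rw [hw, hI4]; simp
    · rw [hI5]; rfl
    · rw [hb, hI6]; rfl

mutual
theorem DV_deriv : ∀ (V : Val) (A n Γ w), DV Unit01 V A n Γ w →
    Nonempty (Deriv Γ w (.val V) (.inter A))
  | .var y, A, n, Γ, w, h => by
    simp only [DV] at h
    obtain ⟨rfl, -, rfl⟩ := h
    exact ⟨.var y A⟩
  | .lam x M, A, n, Γ, w, h => by
    simp only [DV] at h
    obtain ⟨I, h1, h2, rfl, rfl, rfl⟩ :=
      LamD_list (fun n Γ w b hb => DT_deriv M n Γ w b hb) _ _ _ _ h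
    exact ⟨.bang I h1 (fun i => (h2 _ (List.get_mem I i)).some)⟩
theorem DT_deriv : ∀ (M : Tm) (n Γ w b), DT Unit01 M n Γ w b →
    Nonempty (Deriv Γ w M (.dist b))
  | .val V, n, Γ, w, b, h => by
    simp only [DT] at h
    rcases h with ⟨rfl, rfl, rfl, rfl⟩ | ⟨A, rfl, h⟩
    · exact ⟨.zero _⟩
    · obtain ⟨d⟩ := DV_deriv V _ _ _ _ h
      exact ⟨.tval d⟩
  | .app V W, n, Γ, w, b, h => by
    simp only [DT] at h
    rcases h with ⟨rfl, rfl, rfl, rfl⟩ | ⟨A, n1, Γ1, w1, n2, Γ2, w2, h1, h2, rfl, rfl, rfl⟩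
    · exact ⟨.zero _⟩
    · obtain ⟨d⟩ := DV_deriv V _ _ _ _ h1
      obtain ⟨e⟩ := DV_deriv W _ _ _ _ h2
      exact ⟨.app d e⟩
  | .choice M N, n, Γ, w, b, h => by
    simp only [DT] at h
    rcases h with ⟨rfl, rfl, rfl, rfl⟩ |
      ⟨n1, Γ1, w1, b1, n2, Γ2, w2, b2, h1, h2, rfl, rfl, rfl, rfl⟩
    · exact ⟨.zero _⟩
    · obtain ⟨d⟩ := DT_deriv M _ _ _ _ h1
      obtain ⟨e⟩ := DT_deriv N _ _ _ _ h2
      exact ⟨.choice d e⟩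
  | .letin x N M, n, Γ, w, b, h => by
    simp only [DT] at h
    rcases h with ⟨rfl, rfl, rfl, rfl⟩ | ⟨a, n1, Γ1, w1, n2, Γ2, w2, h1, h2, rfl, rfl, rfl⟩
    · exact ⟨.zero _⟩
    · obtain ⟨d⟩ := DT_deriv N _ _ _ _ h1
      obtain ⟨K, h3, h4, rfl, rfl, rfl, rfl⟩ :=
        LetD_list (fun n Γ w b hb => DT_deriv M n Γ w b hb) _ _ _ _ _ h2
      exact ⟨.letin x K h3 (fun i => (h4 _ (List.get_mem K i)).some) d⟩
end

theorem ETime_eq {M : Tm} (hM : fvT M = ∅) :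
    ETime M = ⨆ k, ENNReal.ofReal ((etime k M : ℚ) : ℝ) := by
  rw [ETime, ENNReal.tsum_eq_iSup_nat]
  congr 1; funext k
  rw [← ENNReal.ofReal_sum_of_nonneg]
  · simp [etime]
  · intro i _
    have := (evalP_bounds i M hM).2.1
    have : ((evalP i M : ℚ) : ℝ) ≤ 1 := by exact_mod_cast this
    linarith

/-- **Tight Typing and Termination**: the probability of termination is the
sup of the norms of tight typings, and the expected runtime is the sup of
the weights of tight derivations (in `[0,∞]`). -/
theorem tight_typing_and_termination {M : Tm} (hM : M.Closed) :
    ProbTerm M = sSup {x : ℝ | ∃ (w : ℚ) (a : DTy), Tight a ∧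
        Nonempty (Deriv emptyCtx w M (.dist a)) ∧ x = ((normD a : ℚ) : ℝ)} ∧
    ETime M = sSup {x : ℝ≥0∞ | ∃ (w : ℚ) (a : DTy), Tight a ∧
        Nonempty (Deriv emptyCtx w M (.dist a)) ∧
        x = ENNReal.ofReal ((w : ℚ) : ℝ)} := by
  have hc : fvT M = ∅ := hM
  constructor
  · have hbdd : BddAbove (Set.range fun k => ((evalP k M : ℚ) : ℝ)) := by
      refine ⟨1, ?_⟩
      rintro _ ⟨k, rfl⟩
      have := (evalP_bounds k M hc).2.1
      simp only
      exact_mod_cast this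
    have hle : ∀ x ∈ {x : ℝ | ∃ (w : ℚ) (a : DTy), Tight a ∧
        Nonempty (Deriv emptyCtx w M (.dist a)) ∧ x = ((normD a : ℚ) : ℝ)}, x ≤ ProbTerm M := by
      rintro _ ⟨w, a, ha, ⟨d⟩, rfl⟩
      obtain ⟨n, h⟩ := conv d
      obtain ⟨k, hk, -⟩ := sound n M w a hc h ha
      exact le_trans (by exact_mod_cast hk) (le_ciSup hbdd k)
    apply le_antisymm
    · apply ciSup_le
      intro k
      obtain ⟨n, w, b, h1, h2, h3, -⟩ := complete k M hc
      exact le_csSup ⟨_, hle⟩ ⟨w, b, h2, DT_deriv _ _ _ _ _ h1, by rw [h3]⟩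
    · exact csSup_le ⟨_, 0, [], by simp [Tight], ⟨.zero M⟩, rfl⟩ hle
  · rw [ETime_eq hc]
    apply le_antisymm
    · apply iSup_le
      intro k
      obtain ⟨n, w, b, h1, h2, -, h4⟩ := complete k M hc
      exact le_trans (ENNReal.ofReal_le_ofReal (by exact_mod_cast h4))
        (le_sSup ⟨w, b, h2, DT_deriv _ _ _ _ _ h1, rfl⟩)
    · apply sSup_le
      rintro _ ⟨w, a, ha, ⟨d⟩, rfl⟩
      obtain ⟨n, h⟩ := conv d
      obtain ⟨k, -, hk⟩ := sound n M w a hc h ha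
      exact le_trans (ENNReal.ofReal_le_ofReal (by exact_mod_cast hk))
        (le_iSup (fun k => ENNReal.ofReal ((etime k M : ℚ) : ℝ)) k)

end CbV
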